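/- Let C₁ > 0 and let A : ℂ → ℂ be an entire function whose restriction to ℝ satisfies sup_{x∈ℝ} |A⁽ⁿ⁾(x)| ≤ C₁ⁿ for every n ∈ ℕ₀, and suppose A(z) ≠ 0 for all z ∈ ℂ. Then there exist constants C₂ ∈ ℝ with |C₂| ≤ C₁ and C₃ ∈ ℂ with Re C₃ ≤ 0 such that A(x) = e^{i C₂ x + C₃} for all x ∈ ℝ. -/

import Mathlib

open Real

/-- A nowhere vanishing entire function has an entire logarithm. -/
theorem Differentiable.exists_entire_log {A : ℂ → ℂ} (hA : Differentiable ℂ A)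
    (hnz : ∀ z, A z ≠ 0) :
    ∃ g : ℂ → ℂ, Differentiable ℂ g ∧ ∀ z, A z = Complex.exp (g z) := by
  have hd : Differentiable ℂ (fun z ↦ _root_.deriv A z / A z) :=
    (hA.contDiff (n := 2)).differentiable_deriv_two.div hA hnz
  obtain ⟨h, hh⟩ := hd.isExactOn_univ
  replace hh : ∀ z, HasDerivAt h (_root_.deriv A z / A z) z := fun z ↦ hh z (Set.mem_univ z)
  have hquot : ∀ z, HasDerivAt (fun w ↦ A w * Complex.exp (-h w)) 0 z := fun z ↦ by
    refine ((hA z).hasDerivAt.fun_mul (hh z).fun_neg.cexp).congr_deriv ?_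
    have := hnz z
    field_simp
    ring
  have hconst : ∀ z, A z * Complex.exp (-h z) = A 0 * Complex.exp (-h 0) := fun z ↦
    is_const_of_deriv_eq_zero (fun z ↦ (hquot z).differentiableAt) (fun z ↦ (hquot z).deriv) z 0
  refine ⟨fun z ↦ h z + Complex.log (A 0 * Complex.exp (-h 0)),
    fun z ↦ (hh z).differentiableAt.add_const _, fun z ↦ ?_⟩
  rw [Complex.exp_add, Complex.exp_log (mul_ne_zero (hnz 0) (Complex.exp_ne_zero _)), ← hconst z,
    mul_left_comm, ← Complex.exp_add, add_neg_cancel, Complex.exp_zero, mul_one]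

/-- An entire function of at most linear growth is affine. -/
theorem Differentiable.eq_affine_of_norm_le {g : ℂ → ℂ} (hg : Differentiable ℂ g) {a b : ℝ}
    (ha : 0 ≤ a) (hb : 0 ≤ b) (hbound : ∀ z, ‖g z‖ ≤ a * ‖z‖ + b) :
    ∃ c d : ℂ, ∀ z, g z = c * z + d := by
  have hderiv : ∀ z, ‖_root_.deriv g z‖ ≤ 2 * a + b := fun z ↦ by
    have hz : 0 < ‖z‖ + 1 := by positivity
    refine (Complex.norm_deriv_le_of_forall_mem_sphere_norm_le hz hg.diffContOnCl
      (C := a * (2 * ‖z‖ + 1) + b) fun w hw ↦ (hbound w).trans ?_).trans ?_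
    · have hw' : ‖w - z‖ = ‖z‖ + 1 := by simpa using hw
      have : ‖w‖ ≤ 2 * ‖z‖ + 1 := by linarith [norm_le_norm_add_norm_sub' w z]
      gcongr
    · rw [div_le_iff₀ hz]
      nlinarith [mul_nonneg hb (norm_nonneg z)]
  have hconst := ((hg.contDiff (n := 2)).differentiable_deriv_two).exists_const_forall_eq_of_bounded
    (isBounded_iff_forall_norm_le.2 ⟨2 * a + b, by rintro _ ⟨z, rfl⟩; exact hderiv z⟩)
  obtain ⟨c, hc⟩ := hconst
  have hsub : ∀ z, HasDerivAt (fun w ↦ g w - c * w) 0 z := fun z ↦ by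
    exact ((hg z).hasDerivAt.fun_sub ((hasDerivAt_id z).const_mul c)).congr_deriv (by simp [hc])
  refine ⟨c, g 0, fun z ↦ ?_⟩
  have := is_const_of_deriv_eq_zero (fun z ↦ (hsub z).differentiableAt)
    (fun z ↦ (hsub z).deriv) z 0
  simp only [mul_zero, sub_zero] at this
  linear_combination this

/-- An entire function whose real part has at most linear growth is affine. -/
theorem Differentiable.eq_affine_of_re_le {g : ℂ → ℂ} (hg : Differentiable ℂ g) {C : ℝ}
    (hC : 0 < C) (hbound : ∀ z, (g z).re ≤ C * ‖z‖) :
    ∃ c d : ℂ, ∀ z, g z = c * z + d := by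
  refine hg.eq_affine_of_norm_le (a := 4 * C) (b := 2 * C + 3 * ‖g 0‖) (by positivity)
    (by positivity) fun z ↦ ?_
  have hR : 0 < 2 * ‖z‖ + 1 := by positivity
  have hz : 0 < ‖z‖ + 1 := by positivity
  have key := Complex.borelCaratheodory (f := g) (z := z) (mul_pos hC hR) hg.differentiableOn
    (fun w hw ↦ (hbound w).trans (by
      have : ‖w‖ < 2 * ‖z‖ + 1 := by simpa using hw
      gcongr)) hR (by simp; linarith [norm_nonneg z])
  refine key.trans ?_
  rw [show 2 * ‖z‖ + 1 - ‖z‖ = ‖z‖ + 1 by ring, ← add_div, div_le_iff₀ hz]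
  nlinarith [mul_nonneg hC.le (norm_nonneg z), mul_nonneg (norm_nonneg (g 0)) (norm_nonneg z),
    norm_nonneg (g 0), norm_nonneg z]

/-- An entire function with `‖f⁽ⁿ⁾(0)‖ ≤ Cⁿ` has exponential type at most `C`. -/
theorem Differentiable.norm_le_exp_of_norm_iteratedDeriv_le {f : ℂ → ℂ} (hf : Differentiable ℂ f)
    {C : ℝ} (hbound : ∀ n, ‖iteratedDeriv n f 0‖ ≤ C ^ n) (z : ℂ) :
    ‖f z‖ ≤ Real.exp (C * ‖z‖) := by
  have hexp : HasSum (fun n : ℕ ↦ (C * ‖z‖) ^ n / (n.factorial : ℝ)) (Real.exp (C * ‖z‖)) := by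
    rw [Real.exp_eq_exp_ℝ]
    exact NormedSpace.expSeries_div_hasSum_exp (C * ‖z‖)
  rw [← Complex.taylorSeries_eq_of_entire hf 0 z]
  refine tsum_of_norm_bounded hexp fun n ↦ ?_
  rw [sub_zero, norm_smul, norm_smul, norm_inv, norm_pow, Complex.norm_natCast, mul_pow,
    div_eq_inv_mul, mul_comm (C ^ n)]
  gcongr
  exact hbound n

theorem iteratedDeriv_cexp_affine (c d : ℂ) (n : ℕ) :
    iteratedDeriv n (fun z ↦ Complex.exp (c * z + d)) =
      fun z ↦ c ^ n * Complex.exp (c * z + d) := by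
  induction n with
  | zero => simp
  | succ n ih =>
    rw [iteratedDeriv_succ, ih]
    funext z
    have h := (((hasDerivAt_id z).const_mul c).add_const d).cexp.const_mul (c ^ n)
    simp only [id, mul_one] at h
    rw [h.deriv]
    ring

theorem eq_zero_of_forall_mul_add_nonpos {a b : ℝ} (h : ∀ x : ℝ, a * x + b ≤ 0) : a = 0 := by
  by_contra ha
  have := h ((1 - b) / a)
  rw [mul_div_cancel₀ _ ha] at this
  linarith

theorem le_of_forall_pow_mul_le_pow {a b k : ℝ} (hb : 0 < b) (hk : 0 < k)
    (h : ∀ n : ℕ, a ^ n * k ≤ b ^ n) : a ≤ b := by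
  by_contra! hab
  obtain ⟨n, hn⟩ := pow_unbounded_of_one_lt k⁻¹ ((one_lt_div hb).2 hab)
  rw [div_pow, lt_div_iff₀ (pow_pos hb n), inv_mul_lt_iff₀ hk] at hn
  linarith [h n]

/-- **Classification of non-vanishing entire leading coefficients of exponential
type** (part of the proof of Proposition 2.7): if `A : ℂ → ℂ` is entire, its
derivatives on the real line satisfy `|A⁽ⁿ⁾(x)| ≤ C₁ⁿ`, and `A` has no zeros,
then `A(x) = e^{iC₂x+C₃}` on `ℝ` for some `C₂ ∈ ℝ` with `|C₂| ≤ C₁` and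
`C₃ ∈ ℂ` with `Re C₃ ≤ 0`. -/
theorem entire_nonvanishing_exponential_type
    (C₁ : ℝ) (hC₁ : 0 < C₁) (A : ℂ → ℂ) (hA : Differentiable ℂ A)
    (hbound : ∀ (n : ℕ) (x : ℝ), ‖iteratedDeriv n A (x : ℂ)‖ ≤ C₁ ^ n)
    (hnz : ∀ z : ℂ, A z ≠ 0) :
    ∃ C₂ : ℝ, |C₂| ≤ C₁ ∧ ∃ C₃ : ℂ, C₃.re ≤ 0 ∧
      ∀ x : ℝ, A (x : ℂ) = Complex.exp (Complex.I * (C₂ : ℂ) * (x : ℂ) + C₃) := by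
  obtain ⟨g, hg, hAg⟩ := hA.exists_entire_log hnz
  have hre : ∀ z, (g z).re ≤ C₁ * ‖z‖ := fun z ↦ by
    have := hA.norm_le_exp_of_norm_iteratedDeriv_le
      (fun n ↦ by simpa using hbound n 0) z
    rwa [hAg, Complex.norm_exp, Real.exp_le_exp] at this
  obtain ⟨c, d, hgcd⟩ := hg.eq_affine_of_re_le hC₁ hre
  have hAexp : A = fun z ↦ Complex.exp (c * z + d) := funext fun z ↦ by rw [hAg, hgcd]
  have hline : ∀ x : ℝ, c.re * x + d.re ≤ 0 := fun x ↦ by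
    simpa [hAexp, Complex.norm_exp] using hbound 0 x
  have hcre : c.re = 0 := eq_zero_of_forall_mul_add_nonpos hline
  have hc : ‖c‖ ≤ C₁ := le_of_forall_pow_mul_le_pow hC₁ (Real.exp_pos d.re) fun n ↦ by
    simpa [hAexp, iteratedDeriv_cexp_affine, Complex.norm_exp] using hbound n 0
  refine ⟨c.im, (Complex.abs_im_le_norm c).trans hc, d, by simpa using hline 0, fun x ↦ ?_⟩
  have hci : c = Complex.I * c.im := Complex.ext (by simp [hcre]) (by simp)
  rw [hAexp, ← hci]
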